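/- arXiv:1603.01481 — 4 statements merged into one kernel-verified Lean document; each statement's English description precedes it below -/
import Mathlib

section
/- Fix finite nonempty types ι (sites) and α (states), a finite set Q of finite subsets of ι (cliques), and potentials V : Finset ι → ((ι → α) → ℝ) satisfying locality (for each c ∈ Q, V c x = V c y whenever x and y agree on c). Define the Gibbs probability mass function p x = exp(−∑_{c ∈ Q} V c x) / Z where Z = ∑_{z : ι → α} exp(−∑_{c ∈ Q} V c z), and for l ∈ ι define the neighborhood η(l) = {m ∈ ι | m ≠ l ∧ ∃ c ∈ Q, l ∈ c ∧ m ∈ c}. Then for all l ∈ ι, all v ∈ α, and all patterns x, y : ι → α such that x m = y m for all m ∈ η(l), the local conditional probabilities agree: p (x[l ↦ v]) / ∑_{w ∈ α} p (x[l ↦ w]) = p (y[l ↦ v]) / ∑_{w ∈ α} p (y[l ↦ w]). (Every Gibbs random field is a Markov random field: the conditional probability of the value at a site given all other sites depends only on the values at the neighboring sites.) -/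
/-- If two patterns agree on the neighborhood of `l`, then the total potentials of their updates
at `l` differ by a constant which does not depend on the new value. -/
theorem sum_potential_update {ι α : Type*} [DecidableEq ι]
    (Q : Finset (Finset ι)) (V : Finset ι → (ι → α) → ℝ)
    (hloc : ∀ c ∈ Q, ∀ x y : ι → α, (∀ m ∈ c, x m = y m) → V c x = V c y)
    (l : ι) (x y : ι → α)
    (hη : ∀ m : ι, m ≠ l → (∃ c ∈ Q, l ∈ c ∧ m ∈ c) → x m = y m) (w : α) :
    ∑ c ∈ Q, V c (Function.update x l w) =
      ∑ c ∈ Q, V c (Function.update y l w) + ∑ c ∈ Q with l ∉ c, (V c x - V c y) := by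
  rw [Finset.sum_filter, ← Finset.sum_add_distrib]
  refine Finset.sum_congr rfl fun c hc => ?_
  by_cases hl : l ∈ c
  · rw [if_neg (not_not.mpr hl), add_zero]
    refine hloc c hc _ _ fun m hm => ?_
    rcases eq_or_ne m l with rfl | hml
    · simp
    · simpa [hml] using hη m hml ⟨c, hc, hl, hm⟩
  · have update_eq (z : ι → α) : V c (Function.update z l w) = V c z :=
      hloc c hc _ _ fun m hm => Function.update_of_ne (ne_of_mem_of_not_mem hm hl) _ _
    rw [if_pos hl, update_eq, update_eq, add_sub_cancel]

/-- Every Gibbs random field is a Markov random field: the conditional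
probability of a value at site `l` given all other sites depends only on the values
at the neighboring sites `η l = {m ≠ l | ∃ c ∈ Q, l ∈ c ∧ m ∈ c}`. -/
theorem gibbs_is_markov {ι α : Type*} [Fintype ι] [Fintype α] [Nonempty ι] [Nonempty α]
    [DecidableEq ι]
    (Q : Finset (Finset ι)) (V : Finset ι → (ι → α) → ℝ)
    (hloc : ∀ c ∈ Q, ∀ x y : ι → α, (∀ m ∈ c, x m = y m) → V c x = V c y)
    (p : (ι → α) → ℝ)
    (hp : ∀ z : ι → α, p z =
      Real.exp (-∑ c ∈ Q, V c z) / ∑ z' : ι → α, Real.exp (-∑ c ∈ Q, V c z'))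
    (l : ι) (v : α) (x y : ι → α)
    (hη : ∀ m : ι, m ≠ l → (∃ c ∈ Q, l ∈ c ∧ m ∈ c) → x m = y m) :
    p (Function.update x l v) / ∑ w : α, p (Function.update x l w)
      = p (Function.update y l v) / ∑ w : α, p (Function.update y l w) := by
  have hupdate (w : α) : p (Function.update x l w) =
      Real.exp (-∑ c ∈ Q with l ∉ c, (V c x - V c y)) * p (Function.update y l w) := by
    rw [hp, hp, sum_potential_update Q V hloc l x y hη w, neg_add, Real.exp_add]
    ring
  simp_rw [hupdate, ← Finset.mul_sum]
  exact mul_div_mul_left _ _ (Real.exp_ne_zero _)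
end

section
/- Fix finite nonempty types ι (sites) and α (states), a finite set Q of finite subsets of ι (cliques), and potentials V : Finset ι → ((ι → α) → ℝ) satisfying locality (for each c ∈ Q, V c x = V c y whenever x and y agree on c). Define the Gibbs probability mass function p x = exp(−∑_{c ∈ Q} V c x) / Z where Z = ∑_{z : ι → α} exp(−∑_{c ∈ Q} V c z). Then for every site l ∈ ι, every v ∈ α, and every pattern x : ι → α, the conditional probability of the value v at site l given the rest of the pattern is given by the local energies of the cliques containing l: p (x[l ↦ v]) / ∑_{w ∈ α} p (x[l ↦ w]) = exp(−∑_{c ∈ Q, l ∈ c} V c (x[l ↦ v])) / ∑_{w ∈ α} exp(−∑_{c ∈ Q, l ∈ c} V c (x[l ↦ w])). -/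
/-- For a Gibbs random field, the single-site conditional probability
at site `l` is given by the local energies of the cliques containing `l`. -/
theorem gibbs_local_conditional {ι α : Type*} [Fintype ι] [Fintype α] [Nonempty ι]
    [Nonempty α] [DecidableEq ι]
    (Q : Finset (Finset ι)) (V : Finset ι → (ι → α) → ℝ)
    (hloc : ∀ c ∈ Q, ∀ x y : ι → α, (∀ m ∈ c, x m = y m) → V c x = V c y)
    (p : (ι → α) → ℝ)
    (hp : ∀ z : ι → α, p z =
      Real.exp (-∑ c ∈ Q, V c z) / ∑ z' : ι → α, Real.exp (-∑ c ∈ Q, V c z'))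
    (l : ι) (v : α) (x : ι → α) :
    p (Function.update x l v) / ∑ w : α, p (Function.update x l w)
      = Real.exp (-∑ c ∈ Q.filter (fun c => l ∈ c), V c (Function.update x l v)) /
        ∑ w : α,
          Real.exp (-∑ c ∈ Q.filter (fun c => l ∈ c), V c (Function.update x l w)) := by
  set Z := ∑ z' : ι → α, Real.exp (-∑ c ∈ Q, V c z')
  have hZ : Z ≠ 0 := (Finset.sum_pos (fun _ _ => Real.exp_pos _) Finset.univ_nonempty).ne'
  have hfactor : ∀ w, p (Function.update x l w) =
      Real.exp (-∑ c ∈ Q.filter (fun c => l ∉ c), V c x) / Z *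
        Real.exp (-∑ c ∈ Q.filter (fun c => l ∈ c), V c (Function.update x l w)) := by
    intro w
    have hrest : ∑ c ∈ Q.filter (fun c => l ∉ c), V c (Function.update x l w) =
        ∑ c ∈ Q.filter (fun c => l ∉ c), V c x := by
      refine Finset.sum_congr rfl fun c hc => ?_
      obtain ⟨hcQ, hlc⟩ := Finset.mem_filter.mp hc
      exact hloc c hcQ _ _ fun m hm =>
        Function.update_of_ne (ne_of_mem_of_not_mem hm hlc) w x
    rw [hp, ← Finset.sum_filter_add_sum_filter_not Q (fun c => l ∈ c), hrest, neg_add,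
      Real.exp_add]
    ring
  simp only [hfactor, ← Finset.mul_sum]
  exact mul_div_mul_left _ _ (div_ne_zero (Real.exp_ne_zero _) hZ)
end

section
/- Fix finite nonempty types ι (sites) and α (states), and let p, q : (ι → α) → ℝ be positive probability mass functions on patterns. Suppose that for all patterns x, y : ι → α that differ at exactly one site, p y / p x = q y / q x. Then p = q. (The ratios of probabilities of patterns differing at a single site, equivalently the single-site full conditional probabilities, uniquely determine the joint distribution of a positive random field.) -/
/-- A function on patterns that is unchanged by modifying a single site is constant. -/
lemma eq_of_forall_update_eq {ι α β : Type*} [Fintype ι] [DecidableEq ι] (f : (ι → α) → β)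
    (hf : ∀ (x : ι → α) (l : ι) (a : α), f (Function.update x l a) = f x) (x y : ι → α) :
    f x = f y := by
  have key : ∀ (s : Finset ι) (x : ι → α), (∀ m ∉ s, x m = y m) → f x = f y := by
    intro s
    induction s using Finset.induction_on with
    | empty => exact fun x h => congrArg f (funext fun m => h m (by simp))
    | insert l s _ ih =>
      intro x h
      rw [← hf x l (y l)]
      refine ih _ fun m hm => ?_
      by_cases hml : m = l
      · subst hml
        simp
      · rw [Function.update_of_ne hml]
        exact h m (by simp [hml, hm])
  exact key Finset.univ x (by simp)

/-- The ratios of probabilities of patterns differing at a single site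
uniquely determine the joint distribution of a positive random field. -/
theorem positive_field_determined_by_single_site_ratios {ι α : Type*}
    [Fintype ι] [Fintype α] [DecidableEq ι] [Nonempty ι] [Nonempty α]
    (p q : (ι → α) → ℝ)
    (hp : ∀ z : ι → α, 0 < p z) (hq : ∀ z : ι → α, 0 < q z)
    (hpsum : ∑ z : ι → α, p z = 1) (hqsum : ∑ z : ι → α, q z = 1)
    (hratio : ∀ x y : ι → α,
      (∃ l : ι, x l ≠ y l ∧ ∀ m : ι, m ≠ l → x m = y m) →
      p y / p x = q y / q x) :
    p = q := by
  have hconst := eq_of_forall_update_eq (fun z => p z / q z) fun x l a => by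
    by_cases hxa : x l = a
    · subst hxa
      simp
    · have h := hratio x (Function.update x l a)
        ⟨l, by simpa using hxa, fun m hm => (Function.update_of_ne hm a x).symm⟩
      rw [div_eq_div_iff (hp _).ne' (hq _).ne'] at h
      rw [div_eq_div_iff (hq _).ne' (hq _).ne', h, mul_comm]
  funext x
  have hcross : ∀ y, p x * q y = p y * q x := fun y =>
    (div_eq_div_iff (hq x).ne' (hq y).ne').mp (hconst x y)
  calc
    p x = ∑ y, p x * q y := by rw [← Finset.mul_sum, hqsum, mul_one]
    _ = ∑ y, p y * q x := Finset.sum_congr rfl fun y _ => hcross y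
    _ = q x := by rw [← Finset.sum_mul, hpsum, one_mul]
end

section
/- Fix finite types ι (sites) and α (states), and let C be a nonempty set of patterns that is single-site connected: for any x, y ∈ C there is a finite sequence of patterns in C starting at x and ending at y in which consecutive patterns differ at exactly one site. Let p, q : (ι → α) → ℝ be probability mass functions that are positive exactly on C (p z > 0 and q z > 0 for z ∈ C, p z = q z = 0 for z ∉ C). If p y / p x = q y / q x for all x, y ∈ C that differ at exactly one site, then p = q. (In the presence of constraints, the single-site conditional probabilities together with the constraint set C uniquely determine the conditional joint distribution.) -/
/-- Two patterns differ at exactly one site. -/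
def DifferAtOneSite {ι α : Type*} (x y : ι → α) : Prop :=
  ∃ l : ι, x l ≠ y l ∧ ∀ m : ι, m ≠ l → x m = y m

/-- If the ratios of two functions agree along every step of a path on which they do not vanish,
then the functions are proportional at its endpoints. -/
theorem mul_eq_mul_of_reflTransGen_of_div_eq_div {Ω K : Type*} [Field K] {r : Ω → Ω → Prop}
    {p q : Ω → K}
    (hr : ∀ a b, r a b → p a ≠ 0 ∧ q a ≠ 0 ∧ p b / p a = q b / q a)
    {x y : Ω} (hxy : Relation.ReflTransGen r x y) : p x * q y = q x * p y := by
  induction hxy with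
  | refl => exact mul_comm _ _
  | @tail b c _ hbc ih =>
    obtain ⟨hp, hq, h⟩ := hr b c hbc
    rw [div_eq_div_iff hp hq] at h
    refine mul_right_cancel₀ hq ?_
    linear_combination q c * ih - q x * h

/-- On a single-site connected constraint set `C`, the single-site
ratios together with `C` uniquely determine the (conditional) joint distribution:
two pmfs positive exactly on `C` with equal single-site ratios on `C` coincide. -/
theorem constrained_field_determined_by_single_site_ratios {ι α : Type*}
    [Fintype ι] [Fintype α] [DecidableEq ι]
    (C : Set (ι → α)) (hC : C.Nonempty)
    (hconn : ∀ x ∈ C, ∀ y ∈ C,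
      Relation.ReflTransGen (fun z w => z ∈ C ∧ w ∈ C ∧ DifferAtOneSite z w) x y)
    (p q : (ι → α) → ℝ)
    (hpnn : ∀ z : ι → α, 0 ≤ p z) (hqnn : ∀ z : ι → α, 0 ≤ q z)
    (hpsum : ∑ z : ι → α, p z = 1) (hqsum : ∑ z : ι → α, q z = 1)
    (hppos : ∀ z ∈ C, 0 < p z) (hqpos : ∀ z ∈ C, 0 < q z)
    (hpzero : ∀ z ∉ C, p z = 0) (hqzero : ∀ z ∉ C, q z = 0)
    (hratio : ∀ x ∈ C, ∀ y ∈ C, DifferAtOneSite x y → p y / p x = q y / q x) :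
    p = q := by
  obtain ⟨a, ha⟩ := hC
  have hprop : ∀ y, p a * q y = q a * p y := by
    intro y
    by_cases hy : y ∈ C
    · refine mul_eq_mul_of_reflTransGen_of_div_eq_div ?_ (hconn a ha y hy)
      rintro b c ⟨hb, hc, hbc⟩
      exact ⟨(hppos b hb).ne', (hqpos b hb).ne', hratio b hb c hc hbc⟩
    · rw [hpzero y hy, hqzero y hy, mul_zero, mul_zero]
  have hpq : p a = q a := by
    have h := Finset.sum_congr (rfl : (Finset.univ : Finset (ι → α)) = _) fun y _ => hprop y
    rwa [← Finset.mul_sum, ← Finset.mul_sum, hpsum, hqsum, mul_one, mul_one] at h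
  funext y
  have h := hprop y
  rw [hpq] at h
  exact (mul_left_cancel₀ (hqpos a ha).ne' h).symm
end
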